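/- arXiv:2009.10867 — 2 statements merged into one kernel-verified Lean document; each statement's English description precedes it below -/
import Mathlib

section
/- For every w ∈ EuclideanSpace ℝ (Fin d), F(w) = 1 - 2⟨w, x̄⁺⟩ + 2⟨w, x̄⁻⟩ + (1/T₊)·Σ_{i=1}^{T₊} (⟨w, x⁺ᵢ⟩ - ⟨w, x̄⁺⟩)² + (1/T₋)·Σ_{j=1}^{T₋} (⟨w, x⁻ⱼ⟩ - ⟨w, x̄⁻⟩)² + (⟨w, x̄⁺⟩ - ⟨w, x̄⁻⟩)²; that is, the pairwise least-squares AUC objective decomposes into linear mean-score terms, the within-class variances of the scores, and the squared gap between the mean positive and mean negative scores. -/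
open scoped RealInnerProductSpace
open Finset

/-- The pairwise least-squares AUC surrogate objective. -/
noncomputable def lsAUC (d Tp Tn : ℕ) (xp : Fin Tp → EuclideanSpace ℝ (Fin d))
    (xn : Fin Tn → EuclideanSpace ℝ (Fin d)) (w : EuclideanSpace ℝ (Fin d)) : ℝ :=
  (1 / ((Tp : ℝ) * (Tn : ℝ))) * ∑ i, ∑ j, (1 - ⟪w, xp i - xn j⟫) ^ 2

/-- The mean of the positive samples. -/
noncomputable def meanPos (d Tp : ℕ) (xp : Fin Tp → EuclideanSpace ℝ (Fin d)) :
    EuclideanSpace ℝ (Fin d) :=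
  ((Tp : ℝ))⁻¹ • ∑ i, xp i

/-- The mean of the negative samples. -/
noncomputable def meanNeg (d Tn : ℕ) (xn : Fin Tn → EuclideanSpace ℝ (Fin d)) :
    EuclideanSpace ℝ (Fin d) :=
  ((Tn : ℝ))⁻¹ • ∑ j, xn j

theorem sum_sum_one_sub_sub_sq {m n : ℕ} (a : Fin m → ℝ) (b : Fin n → ℝ) :
    ∑ i, ∑ j, (1 - (a i - b j)) ^ 2
      = m * n - 2 * n * ∑ i, a i + 2 * m * ∑ j, b j + n * ∑ i, a i ^ 2
        - 2 * (∑ i, a i) * ∑ j, b j + m * ∑ j, b j ^ 2 := by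
  have h : ∀ i j, (1 - (a i - b j)) ^ 2
      = 1 - 2 * a i + 2 * b j + a i ^ 2 - 2 * (a i * b j) + b j ^ 2 := fun i j => by ring
  simp only [h, sum_add_distrib, sum_sub_distrib, ← mul_sum, ← sum_mul, sum_const, card_univ,
    Fintype.card_fin, nsmul_eq_mul]
  ring

theorem sum_sub_const_sq {m : ℕ} (a : Fin m → ℝ) (c : ℝ) :
    ∑ i, (a i - c) ^ 2 = ∑ i, a i ^ 2 - 2 * c * ∑ i, a i + m * c ^ 2 := by
  have h : ∀ i, (a i - c) ^ 2 = a i ^ 2 - 2 * c * a i + c ^ 2 := fun i => by ring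
  simp only [h, sum_add_distrib, sum_sub_distrib, ← mul_sum, sum_const, card_univ,
    Fintype.card_fin, nsmul_eq_mul]

/-- The pairwise least-squares AUC objective decomposes into linear mean-score terms,
the within-class variances of the scores, and the squared gap between the mean
positive and mean negative scores. -/
theorem lsAUC_variance_decomposition (d Tp Tn : ℕ) (hd : 1 ≤ d) (hTp : 1 ≤ Tp)
    (hTn : 1 ≤ Tn)
    (xp : Fin Tp → EuclideanSpace ℝ (Fin d)) (xn : Fin Tn → EuclideanSpace ℝ (Fin d))
    (w : EuclideanSpace ℝ (Fin d)) :
    lsAUC d Tp Tn xp xn w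
      = 1 - 2 * ⟪w, meanPos d Tp xp⟫ + 2 * ⟪w, meanNeg d Tn xn⟫
        + (1 / (Tp : ℝ)) * ∑ i, (⟪w, xp i⟫ - ⟪w, meanPos d Tp xp⟫) ^ 2
        + (1 / (Tn : ℝ)) * ∑ j, (⟪w, xn j⟫ - ⟪w, meanNeg d Tn xn⟫) ^ 2
        + (⟪w, meanPos d Tp xp⟫ - ⟪w, meanNeg d Tn xn⟫) ^ 2 := by
  have hp : (Tp : ℝ) ≠ 0 := by positivity
  have hn : (Tn : ℝ) ≠ 0 := by positivity
  simp only [lsAUC, meanPos, meanNeg, inner_sub_right, real_inner_smul_right, inner_sum,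
    sum_sum_one_sub_sub_sq, sum_sub_const_sq]
  field_simp
  ring
end

section
/- The generalized FTRL update has a closed-form coordinatewise soft-thresholding solution: the function Φ(w) = ⟨Σ_{i=1}^{t} g_i, w⟩ + Λ·‖w‖₁ + (1/2)·Σ_{i=1}^{t} Σ_{j=1}^{d} q_{i,j}·(w_j - w_{i,j})² on EuclideanSpace ℝ (Fin d) attains its global minimum at the unique point w* whose coordinates are w*_j = -η_j·sign(z_j)·max(|z_j| - Λ, 0), where η_j = 1/(Σ_{i=1}^{t} q_{i,j}) and z_j = Σ_{i=1}^{t} g_{i,j} - Σ_{i=1}^{t} q_{i,j}·w_{i,j}; that is, Φ(w*) ≤ Φ(w) for all w, with equality only when w = w*. -/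
open scoped RealInnerProductSpace
open Finset

/-- The generalized FTRL objective
`Φ(w) = ⟨Σᵢ gᵢ, w⟩ + Λ·‖w‖₁ + (1/2)·Σᵢ Σⱼ qᵢⱼ·(wⱼ - wᵢⱼ)²`. -/
noncomputable def ftrlObj (d t : ℕ) (Lam : ℝ) (g : Fin t → EuclideanSpace ℝ (Fin d))
    (wPast : Fin t → EuclideanSpace ℝ (Fin d)) (q : Fin t → Fin d → ℝ)
    (w : EuclideanSpace ℝ (Fin d)) : ℝ :=
  ⟪∑ i, g i, w⟫ + Lam * ∑ j, |w j|
    + (1 / 2) * ∑ i, ∑ j, q i j * (w j - wPast i j) ^ 2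

/-- Soft thresholding minimizes `x ↦ z x + Λ |x| + S x² / 2`, with quadratic growth `S / 2`. -/
theorem soft_threshold_quadratic_growth {S Lam : ℝ} (hS : 0 < S) (hLam : 0 ≤ Lam) (z a x : ℝ)
    (ha : a = -(1 / S) * Real.sign z * max (|z| - Lam) 0) :
    z * a + Lam * |a| + S / 2 * a ^ 2 + S / 2 * (x - a) ^ 2
      ≤ z * x + Lam * |x| + S / 2 * x ^ 2 := by
  have hSa : S * a = -(Real.sign z * max (|z| - Lam) 0) := by
    rw [ha]; field_simp
  suffices h : 0 ≤ (z + S * a) * (x - a) + Lam * (|x| - |a|) by linarith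
  rcases le_or_gt |z| Lam with hz | hz
  · have h0 : a = 0 := by rw [ha, max_eq_right (by linarith), mul_zero]
    have h1 : |z| * |x| ≤ Lam * |x| := mul_le_mul_of_nonneg_right hz (abs_nonneg x)
    have h2 := neg_abs_le (z * x)
    rw [abs_mul] at h2
    simp only [h0, abs_zero]
    linarith
  · rw [max_eq_left (by linarith)] at hSa
    rcases lt_trichotomy z 0 with hz0 | rfl | hz0
    · rw [Real.sign_of_neg hz0, abs_of_neg hz0] at hSa
      rw [abs_of_neg hz0] at hz
      have ha0 : 0 < a := by
        by_contra! h
        linarith [mul_nonpos_of_nonneg_of_nonpos hS.le h]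
      rw [abs_of_pos ha0, show z + S * a = -Lam by linarith]
      linarith [mul_le_mul_of_nonneg_left (le_abs_self x) hLam]
    · simp only [abs_zero] at hz
      linarith
    · rw [Real.sign_of_pos hz0, abs_of_pos hz0] at hSa
      rw [abs_of_pos hz0] at hz
      have ha0 : a < 0 := by
        by_contra! h
        linarith [mul_nonneg hS.le h]
      rw [abs_of_neg ha0, show z + S * a = Lam by linarith]
      linarith [mul_le_mul_of_nonneg_left (neg_abs_le x) hLam]

/-- The FTRL objective separates over coordinates, up to a constant. -/
theorem ftrlObj_eq_sum (d t : ℕ) (Lam : ℝ) (g : Fin t → EuclideanSpace ℝ (Fin d))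
    (wPast : Fin t → EuclideanSpace ℝ (Fin d)) (q : Fin t → Fin d → ℝ)
    (w : EuclideanSpace ℝ (Fin d)) :
    ftrlObj d t Lam g wPast q w =
      ∑ j, (((∑ i, g i j) - ∑ i, q i j * wPast i j) * w j + Lam * |w j|
        + (∑ i, q i j) / 2 * w j ^ 2)
      + ∑ j, (1 / 2) * ∑ i, q i j * wPast i j ^ 2 := by
  have hinner : ⟪∑ i, g i, w⟫ = ∑ j, (∑ i, g i j) * w j := by
    simp [PiLp.inner_apply, mul_comm]
  rw [ftrlObj, hinner, sum_comm, mul_sum, mul_sum, ← sum_add_distrib, ← sum_add_distrib,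
    ← sum_add_distrib]
  refine sum_congr rfl fun j _ => ?_
  have hsq : ∑ i, q i j * (w j - wPast i j) ^ 2 =
      (∑ i, q i j) * w j ^ 2 - 2 * (∑ i, q i j * wPast i j) * w j
        + ∑ i, q i j * wPast i j ^ 2 := by
    rw [mul_sum, sum_mul, sum_mul, ← sum_sub_distrib, ← sum_add_distrib]
    exact sum_congr rfl fun i _ => by ring
  rw [hsq]
  ring

/-- The generalized FTRL update has a closed-form coordinatewise soft-thresholding
solution: `Φ` attains its global minimum at the unique point `w*` with
`w*ⱼ = -ηⱼ·sign(zⱼ)·max(|zⱼ| - Λ, 0)`, where `ηⱼ = 1/(Σᵢ qᵢⱼ)` and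
`zⱼ = Σᵢ gᵢⱼ - Σᵢ qᵢⱼ·wᵢⱼ`. -/
theorem ftrl_soft_thresholding_minimizer (d t : ℕ) (hd : 1 ≤ d) (ht : 1 ≤ t)
    (Lam : ℝ) (hLam : 0 ≤ Lam)
    (g : Fin t → EuclideanSpace ℝ (Fin d)) (wPast : Fin t → EuclideanSpace ℝ (Fin d))
    (q : Fin t → Fin d → ℝ) (hq : ∀ i j, 0 < q i j)
    (eta : Fin d → ℝ) (heta : ∀ j, eta j = 1 / ∑ i, q i j)
    (z : Fin d → ℝ) (hz : ∀ j, z j = (∑ i, g i j) - ∑ i, q i j * wPast i j)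
    (wStar : EuclideanSpace ℝ (Fin d))
    (hwStar : ∀ j, wStar j = -eta j * Real.sign (z j) * max (|z j| - Lam) 0) :
    ∀ w : EuclideanSpace ℝ (Fin d),
      ftrlObj d t Lam g wPast q wStar ≤ ftrlObj d t Lam g wPast q w
        ∧ (ftrlObj d t Lam g wPast q wStar = ftrlObj d t Lam g wPast q w → w = wStar) := by
  intro w
  have hS : ∀ j, 0 < ∑ i, q i j := fun j =>
    sum_pos (fun i _ => hq i j) ⟨⟨0, ht⟩, mem_univ _⟩
  have hgrowth : ftrlObj d t Lam g wPast q wStar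
      + ∑ j, (∑ i, q i j) / 2 * (w j - wStar j) ^ 2 ≤ ftrlObj d t Lam g wPast q w := by
    rw [ftrlObj_eq_sum, ftrlObj_eq_sum, add_right_comm, ← sum_add_distrib]
    refine add_le_add (sum_le_sum fun j _ => ?_) le_rfl
    rw [← hz j]
    exact soft_threshold_quadratic_growth (hS j) hLam (z j) (wStar j) (w j)
      (by rw [hwStar j, heta j])
  have hnonneg : ∀ j ∈ univ, 0 ≤ (∑ i, q i j) / 2 * (w j - wStar j) ^ 2 := fun j _ =>
    mul_nonneg (half_pos (hS j)).le (sq_nonneg _)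
  have hsum := sum_nonneg hnonneg
  refine ⟨by linarith, fun heq => ?_⟩
  have hzero := (sum_eq_zero_iff_of_nonneg hnonneg).1 (le_antisymm (by linarith) hsum)
  ext j
  have hj := (mul_eq_zero.1 (hzero j (mem_univ j))).resolve_left (half_pos (hS j)).ne'
  exact sub_eq_zero.1 (pow_eq_zero_iff two_ne_zero |>.1 hj)
end
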